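/- (Relative entropy estimate, part (II), relative stress bound.) Let ê : ℝ¹⁹×[0,∞) → ℝ (with ξ = (F,ζ,w) ∈ M₃(ℝ)×M₃(ℝ)×ℝ) be C³, uniformly convex (∇²_{(ξ,η)}ê ≥ c𝕀 for some c > 0), and satisfy the growth conditions (G1)–(G3) with exponents p ≥ 4, q ≥ 2, ρ > 1, ℓ > 1. Then for every M > 0 there is a constant C₂ > 0 such that for all (F,v,η) ∈ M₃(ℝ)×ℝ³×[0,∞) and all (F̄,v̄,η̄) ∈ Γ_M: | (∇_ξ ê)(Φ(F),η | Φ(F̄),η̄) | ≤ C₂ · I(v,Φ(F),η | v̄,Φ(F̄),η̄), where (∇_ξ ê)(ξ,η|ξ̄,η̄) denotes the ℝ¹⁹ vector with components (∂ê/∂ξ^B)(ξ,η) − (∂ê/∂ξ^B)(ξ̄,η̄) − Σ_A (∂²ê/∂ξ^B∂ξ^A)(ξ̄,η̄)(ξ−ξ̄)^A − (∂²ê/∂ξ^B∂η)(ξ̄,η̄)(η−η̄). -/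

import Mathlib

open scoped BigOperators
noncomputable section

/-- 3×3 real matrices, modelled as `Fin 3 → Fin 3 → ℝ`. -/
abbrev Mat : Type := Fin 3 → Fin 3 → ℝ

/-- The Levi-Civita symbol on `{0,1,2}`. -/
def lc (i j k : Fin 3) : ℝ :=
  (((j : ℕ) : ℝ) - ((i : ℕ) : ℝ)) * (((k : ℕ) : ℝ) - ((i : ℕ) : ℝ)) *
    (((k : ℕ) : ℝ) - ((j : ℕ) : ℝ)) / 2

/-- The cofactor matrix `(cof F)_{iα} = (1/2) Σ ε_{ijk} ε_{αβγ} F_{jβ} F_{kγ}`. -/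
def cof (F : Mat) : Mat := fun i α =>
  (1 / 2) * ∑ j, ∑ k, ∑ β, ∑ γ, lc i j k * lc α β γ * F j β * F k γ

/-- The determinant `det F = (1/6) Σ ε_{ijk} ε_{αβγ} F_{iα} F_{jβ} F_{kγ}`. -/
def mdet (F : Mat) : ℝ :=
  (1 / 6) * ∑ i, ∑ j, ∑ k, ∑ α, ∑ β, ∑ γ, lc i j k * lc α β γ * F i α * F j β * F k γ

/-- Frobenius norm of a 3×3 matrix. -/
def frob (F : Mat) : ℝ := Real.sqrt (∑ i, ∑ j, F i j ^ 2)

/-- The extended state space `ξ = (F, ζ, w) ∈ M₃(ℝ) × M₃(ℝ) × ℝ ≅ ℝ¹⁹`. -/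
abbrev Xi : Type := Mat × Mat × ℝ

/-- Extended state together with the entropy: `(ξ, η) ∈ ℝ¹⁹ × ℝ`. -/
abbrev XE : Type := Xi × ℝ

/-- The natural domain `{η ≥ 0}` of the internal energy. -/
def Dom : Set XE := {x | 0 ≤ x.2}

/-- The null-Lagrangian vector `Φ(F) = (F, cof F, det F)`. -/
def Phi (F : Mat) : Xi := (F, cof F, mdet F)

/-- Directional derivative of `eh` at `x` in the pure-`ξ` direction `d`
(equivalently `Σ_B (∂eh/∂ξ^B)(x) d^B`), taken within the domain `{η ≥ 0}`. -/
def dXi (eh : XE → ℝ) (x : XE) (d : Xi) : ℝ :=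
  fderivWithin ℝ eh Dom x (d, 0)

/-- `θ̂ = ∂eh/∂η`, taken within the domain `{η ≥ 0}`. -/
def dEta (eh : XE → ℝ) (x : XE) : ℝ :=
  fderivWithin ℝ eh Dom x (0, 1)

/-- Matrix of partial derivatives `∂eh/∂F`. -/
def dFmat (eh : XE → ℝ) (x : XE) : Mat :=
  fun i j => dXi eh x (Pi.single i (Pi.single j 1), 0, 0)

/-- Matrix of partial derivatives `∂eh/∂ζ`. -/
def dZmat (eh : XE → ℝ) (x : XE) : Mat :=
  fun i j => dXi eh x (0, Pi.single i (Pi.single j 1), 0)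

/-- Partial derivative `∂eh/∂w`. -/
def dW (eh : XE → ℝ) (x : XE) : ℝ := dXi eh x (0, 0, 1)

/-- Second directional derivative of `eh` at `x`, in directions `u` (outer) and
`d` (inner), within the domain `{η ≥ 0}`. -/
def d2 (eh : XE → ℝ) (x : XE) (u d : XE) : ℝ :=
  fderivWithin ℝ (fun y => fderivWithin ℝ eh Dom y d) Dom x u

/-- The weight `|F|^p + |ζ|^q + |w|^ρ + |η|^ℓ` appearing in the growth conditions. -/
def bigN (p q ρ ℓ : ℝ) (x : XE) : ℝ :=
  frob x.1.1 ^ p + frob x.1.2.1 ^ q + |x.1.2.2| ^ ρ + |x.2| ^ ℓ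

/-- Uniform convexity `∇²_{(ξ,η)} eh ≥ c 𝕀` (as quadratic forms, with the Euclidean
norm on `ℝ¹⁹ × ℝ`). -/
def UnifConvex (eh : XE → ℝ) (c : ℝ) : Prop :=
  ∀ x ∈ Dom, ∀ d : XE,
    c * (frob d.1.1 ^ 2 + frob d.1.2.1 ^ 2 + d.1.2.2 ^ 2 + d.2 ^ 2) ≤ d2 eh x d d

/-- Growth condition (G1): `c N(ξ,η) - c ≤ eh(ξ,η) ≤ c N(ξ,η) + c`. -/
def GrowthG1 (eh : XE → ℝ) (c p q ρ ℓ : ℝ) : Prop :=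
  ∀ x ∈ Dom, c * bigN p q ρ ℓ x - c ≤ eh x ∧ eh x ≤ c * bigN p q ρ ℓ x + c

/-- Growth condition (G2): `∂_η eh / N → 0` as `N → ∞`. -/
def GrowthG2 (eh : XE → ℝ) (p q ρ ℓ : ℝ) : Prop :=
  ∀ ε > (0:ℝ), ∃ R : ℝ, ∀ x ∈ Dom, R ≤ bigN p q ρ ℓ x → |dEta eh x| ≤ ε * bigN p q ρ ℓ x

/-- Growth condition (G3):
`|∂_F eh|^{p/(p-1)} + |∂_ζ eh|^{p/(p-2)} + |∂_w eh|^{p/(p-3)} ≤ c N + c`. -/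
def GrowthG3 (eh : XE → ℝ) (c p q ρ ℓ : ℝ) : Prop :=
  ∀ x ∈ Dom,
    frob (dFmat eh x) ^ (p / (p-1)) + frob (dZmat eh x) ^ (p / (p-2))
      + |dW eh x| ^ (p / (p-3)) ≤ c * bigN p q ρ ℓ x + c

/-- The relative internal energy
`eh(ξ,η | ξ̄,η̄) = eh(ξ,η) − eh(ξ̄,η̄) − ∇_ξ eh(ξ̄,η̄)·(ξ−ξ̄) − ∂_η eh(ξ̄,η̄)(η−η̄)`. -/
def erel (eh : XE → ℝ) (x xb : XE) : ℝ :=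
  eh x - eh xb - dXi eh xb (x.1 - xb.1) - dEta eh xb * (x.2 - xb.2)

/-- The relative total energy `I(v,ξ,η | v̄,ξ̄,η̄) = ½|v−v̄|² + eh(ξ,η|ξ̄,η̄)`. -/
def relI (eh : XE → ℝ) (v vb : Fin 3 → ℝ) (x xb : XE) : ℝ :=
  (1/2) * (∑ i, (v i - vb i)^2) + erel eh x xb

/-- The compact set `Γ_M = {(F̄,v̄,η̄) : |F̄| ≤ M, |v̄| ≤ M, 0 ≤ η̄ ≤ M}`. -/
def Gam (M : ℝ) (Fb : Mat) (vb : Fin 3 → ℝ) (ηb : ℝ) : Prop :=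
  frob Fb ≤ M ∧ Real.sqrt (∑ i, (vb i)^2) ≤ M ∧ 0 ≤ ηb ∧ ηb ≤ M

/-- `|Φ(F) − Φ(F̄)|²` (squared Euclidean distance of the null-Lagrangian vectors). -/
def phidist (F Fb : Mat) : ℝ :=
  frob (F - Fb) ^ 2 + frob (cof F - cof Fb) ^ 2 + (mdet F - mdet Fb) ^ 2

/-- The `B`-component of the relative stress vector `(∇_ξ eh)(ξ,η | ξ̄,η̄)` in the
`ξ`-direction `d`:
`(∂eh/∂ξ^B)(x) − (∂eh/∂ξ^B)(x̄) − Σ_A (∂²eh/∂ξ^B∂ξ^A)(x̄)(ξ−ξ̄)^A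
  − (∂²eh/∂ξ^B∂η)(x̄)(η−η̄)`. -/
def relS (eh : XE → ℝ) (x xb : XE) (d : Xi) : ℝ :=
  dXi eh x d - dXi eh xb d
    - fderivWithin ℝ (fun y => dXi eh y d) Dom xb (x.1 - xb.1, x.2 - xb.2)

/-- Euclidean norm of the relative stress vector `(∇_ξ eh)(ξ,η | ξ̄,η̄) ∈ ℝ¹⁹`. -/
def relSnorm (eh : XE → ℝ) (x xb : XE) : ℝ :=
  Real.sqrt
    ((∑ i, ∑ j, (relS eh x xb (Pi.single i (Pi.single j 1), 0, 0))^2)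
      + (∑ i, ∑ j, (relS eh x xb (0, Pi.single i (Pi.single j 1), 0))^2)
      + (relS eh x xb (0, 0, 1))^2)

lemma frob_nonneg (F : Mat) : 0 ≤ frob F := Real.sqrt_nonneg _

lemma abs_apply_le_frob (F : Mat) (i j : Fin 3) : |F i j| ≤ frob F := by
  refine Real.abs_le_sqrt ?_
  calc F i j ^ 2 ≤ ∑ j, F i j ^ 2 :=
        Finset.single_le_sum (f := fun j => F i j ^ 2) (fun _ _ => sq_nonneg _) (Finset.mem_univ j)
    _ ≤ ∑ i, ∑ j, F i j ^ 2 :=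
        Finset.single_le_sum (f := fun i => ∑ j, F i j ^ 2)
          (fun _ _ => Finset.sum_nonneg fun _ _ => sq_nonneg _) (Finset.mem_univ i)

lemma norm_le_frob (F : Mat) : ‖F‖ ≤ frob F :=
  (pi_norm_le_iff_of_nonneg (frob_nonneg F)).2 fun i =>
    (pi_norm_le_iff_of_nonneg (frob_nonneg F)).2 fun j => abs_apply_le_frob F i j

lemma norm_sq_le_euclidean (h : XE) :
    ‖h‖ ^ 2 ≤ frob h.1.1 ^ 2 + frob h.1.2.1 ^ 2 + h.1.2.2 ^ 2 + h.2 ^ 2 := by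
  have h1 := norm_le_frob h.1.1
  have h2 := norm_le_frob h.1.2.1
  have h3 := sq_nonneg (frob h.1.1)
  have h4 := sq_nonneg (frob h.1.2.1)
  have h5 := sq_nonneg h.1.2.2
  have h6 := sq_nonneg h.2
  refine Real.le_sqrt (norm_nonneg _) (by positivity) |>.1 ?_
  refine norm_prod_le_iff.2 ⟨norm_prod_le_iff.2 ⟨?_, norm_prod_le_iff.2 ⟨?_, ?_⟩⟩, ?_⟩
  · exact h1.trans (Real.le_sqrt_of_sq_le (by linarith))
  · exact h2.trans (Real.le_sqrt_of_sq_le (by linarith))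
  · exact Real.abs_le_sqrt (by linarith)
  · exact Real.abs_le_sqrt (by linarith)

lemma norm_le_sum_frob (x : XE) :
    ‖x‖ ≤ frob x.1.1 + frob x.1.2.1 + |x.1.2.2| + |x.2| := by
  have h1 := norm_le_frob x.1.1
  have h2 := norm_le_frob x.1.2.1
  have h3 := frob_nonneg x.1.1
  have h4 := frob_nonneg x.1.2.1
  have h5 := abs_nonneg x.1.2.2
  have h6 := abs_nonneg x.2
  refine norm_prod_le_iff.2 ⟨norm_prod_le_iff.2 ⟨?_, norm_prod_le_iff.2 ⟨?_, ?_⟩⟩, ?_⟩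
  · linarith
  · linarith
  · rw [Real.norm_eq_abs]; linarith
  · rw [Real.norm_eq_abs]; linarith

lemma bigN_nonneg (p q ρ ℓ : ℝ) (x : XE) : 0 ≤ bigN p q ρ ℓ x := by
  have h1 := frob_nonneg x.1.1
  have h2 := frob_nonneg x.1.2.1
  unfold bigN
  positivity

lemma exists_le_mul_rpow_add {r ε : ℝ} (hr : 1 < r) (hε : 0 < ε) :
    ∃ C, ∀ t : ℝ, 0 ≤ t → t ≤ ε * t ^ r + C := by
  obtain ⟨T, hT⟩ := Filter.eventually_atTop.1
    ((tendsto_rpow_atTop (sub_pos.2 hr)).eventually_ge_atTop (1 / ε))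
  refine ⟨max T 1, fun t ht => ?_⟩
  have h0 : 0 ≤ ε * t ^ r := by positivity
  rcases le_total t (max T 1) with h | h
  · linarith
  · have htpos : 0 < t := lt_of_lt_of_le one_pos ((le_max_right _ _).trans h)
    have h1 := hT t ((le_max_left _ _).trans h)
    rw [Real.rpow_sub_one htpos.ne', div_le_div_iff₀ hε htpos] at h1
    linarith [le_max_right T 1]

lemma exists_norm_le_mul_bigN_add {p q ρ ℓ ε : ℝ} (hp : 1 < p) (hq : 1 < q) (hρ : 1 < ρ)
    (hℓ : 1 < ℓ) (hε : 0 < ε) :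
    ∃ C, ∀ x : XE, ‖x‖ ≤ ε * bigN p q ρ ℓ x + C := by
  obtain ⟨C1, h1⟩ := exists_le_mul_rpow_add hp hε
  obtain ⟨C2, h2⟩ := exists_le_mul_rpow_add hq hε
  obtain ⟨C3, h3⟩ := exists_le_mul_rpow_add hρ hε
  obtain ⟨C4, h4⟩ := exists_le_mul_rpow_add hℓ hε
  refine ⟨C1 + C2 + C3 + C4, fun x => ?_⟩
  have h5 := norm_le_sum_frob x
  have := h1 _ (frob_nonneg x.1.1)
  have := h2 _ (frob_nonneg x.1.2.1)
  have := h3 _ (abs_nonneg x.1.2.2)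
  have := h4 _ (abs_nonneg x.2)
  unfold bigN
  linarith

lemma le_add_one_of_rpow_le {a r y : ℝ} (hr : 1 ≤ r) (hy : 0 ≤ y) (h : a ^ r ≤ y) :
    a ≤ y + 1 := by
  rcases le_total a 1 with h1 | h1
  · linarith
  · linarith [Real.self_le_rpow_of_one_le h1 hr]

lemma convex_Dom : Convex ℝ Dom :=
  (convex_Ici (0 : ℝ)).is_linear_preimage (LinearMap.snd ℝ Xi ℝ).isLinear

lemma isClosed_Dom : IsClosed Dom := isClosed_le continuous_const continuous_snd

lemma uniqueDiffOn_Dom : UniqueDiffOn ℝ Dom := by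
  refine uniqueDiffOn_convex convex_Dom ⟨(0, 1), ?_⟩
  refine mem_interior.2 ⟨{x | 0 < x.2}, fun x (hx : 0 < x.2) => hx.le,
    isOpen_lt continuous_const continuous_snd, ?_⟩
  simp

lemma isCompact_Dom_inter (R : ℝ) : IsCompact (Dom ∩ Metric.closedBall (0 : XE) R) :=
  (isCompact_closedBall _ _).inter_left isClosed_Dom

lemma convex_Dom_inter (R : ℝ) : Convex ℝ (Dom ∩ Metric.closedBall (0 : XE) R) :=
  convex_Dom.inter (convex_closedBall _ _)

lemma contDiffOn_fderivWithin_Dom {eh : XE → ℝ} (hC3 : ContDiffOn ℝ 3 eh Dom) :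
    ContDiffOn ℝ 2 (fderivWithin ℝ eh Dom) Dom :=
  hC3.fderivWithin uniqueDiffOn_Dom (by norm_num)

lemma contDiffOn_directional_deriv {eh : XE → ℝ} (hC3 : ContDiffOn ℝ 3 eh Dom) (d : XE) :
    ContDiffOn ℝ 2 (fun y => fderivWithin ℝ eh Dom y d) Dom :=
  (contDiffOn_fderivWithin_Dom hC3).clm_apply contDiffOn_const

lemma erel_eq (eh : XE → ℝ) (x xb : XE) :
    erel eh x xb = eh x - eh xb - fderivWithin ℝ eh Dom xb (x - xb) := by
  have : x - xb = (x.1 - xb.1, 0) + (x.2 - xb.2) • ((0, 1) : XE) := by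
    ext <;> simp
  rw [this, map_add, map_smul]
  simp only [erel, dXi, dEta, smul_eq_mul]
  ring

lemma hasDerivWithinAt_comp_line {g : XE → ℝ} (hg : DifferentiableOn ℝ g Dom) {x xb : XE}
    (hx : x ∈ Dom) (hxb : xb ∈ Dom) {t : ℝ} (ht : t ∈ Set.Icc (0 : ℝ) 1) :
    HasDerivWithinAt (fun t : ℝ => g (xb + t • (x - xb)))
      (fderivWithin ℝ g Dom (xb + t • (x - xb)) (x - xb)) (Set.Icc 0 1) t := by
  have hmaps : Set.MapsTo (fun t : ℝ => xb + t • (x - xb)) (Set.Icc 0 1) Dom :=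
    fun s hs => convex_Dom.add_smul_sub_mem hxb hx hs
  have hline : HasDerivWithinAt (fun t : ℝ => xb + t • (x - xb)) (x - xb) (Set.Icc 0 1) t := by
    simpa using (((hasDerivAt_id t).smul_const (x - xb)).const_add xb).hasDerivWithinAt
  exact ((hg _ (hmaps ht)).hasFDerivWithinAt).comp_hasDerivWithinAt t hline hmaps

lemma le_erel {eh : XE → ℝ} {c : ℝ} (hc : 0 < c) (hC3 : ContDiffOn ℝ 3 eh Dom)
    (hconv : UnifConvex eh c) {x xb : XE} (hx : x ∈ Dom) (hxb : xb ∈ Dom) :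
    c / 2 * ‖x - xb‖ ^ 2 ≤ erel eh x xb := by
  set h := x - xb with hh
  set γ : ℝ → XE := fun t => xb + t • h with hγ
  have hγ_mem : ∀ t ∈ Set.Icc (0 : ℝ) 1, γ t ∈ Dom :=
    fun s hs => convex_Dom.add_smul_sub_mem hxb hx hs
  have hd0 : ∀ t ∈ Set.Icc (0 : ℝ) 1, HasDerivWithinAt (fun t => eh (γ t))
      (fderivWithin ℝ eh Dom (γ t) h) (Set.Icc 0 1) t := fun t ht =>
    hasDerivWithinAt_comp_line (hC3.differentiableOn (by norm_num)) hx hxb ht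
  have hd1 : ∀ t ∈ Set.Icc (0 : ℝ) 1, HasDerivWithinAt (fun t => fderivWithin ℝ eh Dom (γ t) h)
      (d2 eh (γ t) h h) (Set.Icc 0 1) t := fun t ht =>
    hasDerivWithinAt_comp_line
      ((contDiffOn_directional_deriv hC3 h).differentiableOn (by norm_num)) hx hxb ht
  have hd2 : ∀ t ∈ Set.Icc (0 : ℝ) 1, c * ‖h‖ ^ 2 ≤ d2 eh (γ t) h h := fun t ht =>
    (mul_le_mul_of_nonneg_left (norm_sq_le_euclidean h) hc.le).trans (hconv _ (hγ_mem t ht) h)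
  have hm1 : MonotoneOn (fun t => fderivWithin ℝ eh Dom (γ t) h - t * (c * ‖h‖ ^ 2))
      (Set.Icc 0 1) := by
    have hder : ∀ t ∈ Set.Icc (0 : ℝ) 1, HasDerivWithinAt
        (fun t => fderivWithin ℝ eh Dom (γ t) h - t * (c * ‖h‖ ^ 2))
        (d2 eh (γ t) h h - 1 * (c * ‖h‖ ^ 2)) (Set.Icc 0 1) t := fun t ht =>
      (hd1 t ht).sub ((hasDerivWithinAt_id t _).mul_const _)
    refine monotoneOn_of_hasDerivWithinAt_nonneg (convex_Icc 0 1)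
      (fun t ht => (hder t ht).continuousWithinAt)
      (fun t ht => (hder t (interior_subset ht)).mono interior_subset) fun t ht => ?_
    linarith [hd2 t (interior_subset ht)]
  have hm0 : MonotoneOn
      (fun t => eh (γ t) - t * fderivWithin ℝ eh Dom (γ 0) h - t ^ 2 * (c / 2 * ‖h‖ ^ 2))
      (Set.Icc 0 1) := by
    have hder : ∀ t ∈ Set.Icc (0 : ℝ) 1, HasDerivWithinAt
        (fun t => eh (γ t) - t * fderivWithin ℝ eh Dom (γ 0) h - t ^ 2 * (c / 2 * ‖h‖ ^ 2))
        (fderivWithin ℝ eh Dom (γ t) h - 1 * fderivWithin ℝ eh Dom (γ 0) h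
          - (2 * t) * (c / 2 * ‖h‖ ^ 2)) (Set.Icc 0 1) t := fun t ht => by
      refine ((hd0 t ht).sub ((hasDerivWithinAt_id t _).mul_const _)).sub
        (HasDerivWithinAt.mul_const ?_ _)
      simpa using (hasDerivAt_pow 2 t).hasDerivWithinAt
    refine monotoneOn_of_hasDerivWithinAt_nonneg (convex_Icc 0 1)
      (fun t ht => (hder t ht).continuousWithinAt)
      (fun t ht => (hder t (interior_subset ht)).mono interior_subset) fun t ht => ?_
    have ht' := interior_subset ht
    have := hm1 (Set.left_mem_Icc.2 zero_le_one) ht' ht'.1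
    simp only at this
    linarith
  have h01 := hm0 (Set.left_mem_Icc.2 zero_le_one) (Set.right_mem_Icc.2 zero_le_one) zero_le_one
  have hγ0 : γ 0 = xb := by simp [hγ]
  have hγ1 : γ 1 = x := by simp [hγ, hh]
  simp only [hγ0, hγ1] at h01
  rw [erel_eq]
  linarith

lemma exists_taylor_bound {g : XE → ℝ} (hg : ContDiffOn ℝ 2 g Dom) (R : ℝ) :
    ∃ L, 0 ≤ L ∧ ∀ x ∈ Dom, ∀ xb ∈ Dom, ‖x‖ ≤ R → ‖xb‖ ≤ R →
      |g x - g xb - fderivWithin ℝ g Dom xb (x - xb)| ≤ L * ‖x - xb‖ ^ 2 := by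
  have hg1 : ContDiffOn ℝ 1 (fderivWithin ℝ g Dom) Dom :=
    hg.fderivWithin uniqueDiffOn_Dom (by norm_num)
  obtain ⟨L, hL⟩ := (isCompact_Dom_inter R).exists_bound_of_continuousOn
    ((hg1.continuousOn_fderivWithin uniqueDiffOn_Dom le_rfl).mono Set.inter_subset_left)
  refine ⟨max L 0, le_max_right _ _, fun x hx xb hxb hxR hxbR => ?_⟩
  have hxS : x ∈ Dom ∩ Metric.closedBall (0 : XE) R := ⟨hx, by simpa using hxR⟩
  have hxbS : xb ∈ Dom ∩ Metric.closedBall (0 : XE) R := ⟨hxb, by simpa using hxbR⟩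
  have hseg : segment ℝ xb x ⊆ Dom ∩ Metric.closedBall (0 : XE) R :=
    (convex_Dom_inter R).segment_subset hxbS hxS
  have hlip : ∀ y ∈ segment ℝ xb x,
      ‖fderivWithin ℝ g Dom y - fderivWithin ℝ g Dom xb‖ ≤ max L 0 * ‖x - xb‖ := fun y hy => by
    refine ((convex_Dom_inter R).norm_image_sub_le_of_norm_hasFDerivWithin_le
      (fun z hz => ((hg1.differentiableOn one_ne_zero z hz.1).hasFDerivWithinAt).mono
        Set.inter_subset_left) (fun z hz => (hL z hz).trans (le_max_left L 0)) hxbS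
      (hseg hy)).trans ?_
    exact mul_le_mul_of_nonneg_left (norm_sub_le_of_mem_segment hy) (le_max_right _ _)
  have := (convex_segment xb x).norm_image_sub_le_of_norm_hasFDerivWithin_le'
    (fun z hz => ((hg.differentiableOn (by norm_num) z (hseg hz).1).hasFDerivWithinAt).mono
      (fun w hw => (hseg hw).1)) hlip (left_mem_segment ℝ xb x) (right_mem_segment ℝ xb x)
  rw [Real.norm_eq_abs] at this
  linarith

lemma exists_abs_relS_le {c cg p q ρ ℓ : ℝ} {eh : XE → ℝ} (hc : 0 < c) (hcg : 0 < cg)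
    (hp : 1 < p) (hq : 1 < q) (hρ : 1 < ρ) (hℓ : 1 < ℓ) (hC3 : ContDiffOn ℝ 3 eh Dom)
    (hconv : UnifConvex eh c) (hG1 : GrowthG1 eh cg p q ρ ℓ) {d : Xi} {B : ℝ}
    (hB : ∀ x ∈ Dom, |dXi eh x d| ≤ B * (bigN p q ρ ℓ x + 1)) (R : ℝ) :
    ∃ K, ∀ x ∈ Dom, ∀ xb ∈ Dom, ‖xb‖ ≤ R → |relS eh x xb d| ≤ K * erel eh x xb := by
  have hg : ContDiffOn ℝ 2 (fun y => dXi eh y d) Dom := contDiffOn_directional_deriv hC3 (d, 0)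
  have hbound : ∀ {E : Type} [NormedAddCommGroup E] (f : XE → E), ContinuousOn f Dom →
      ∃ A, 0 ≤ A ∧ ∀ xb ∈ Dom, ‖xb‖ ≤ R → ‖f xb‖ ≤ A := fun f hf => by
    obtain ⟨A, hA⟩ := (isCompact_Dom_inter R).exists_bound_of_continuousOn
      (hf.mono Set.inter_subset_left)
    exact ⟨max A 0, le_max_right _ _, fun xb hxb hR =>
      (hA xb ⟨hxb, by simpa using hR⟩).trans (le_max_left _ _)⟩
  obtain ⟨E, -, hE⟩ := hbound eh hC3.continuousOn
  obtain ⟨A, hA0, hA⟩ := hbound _ (contDiffOn_fderivWithin_Dom hC3).continuousOn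
  obtain ⟨D, hD0, hD⟩ := hbound _ hg.continuousOn
  obtain ⟨G, hG0, hG⟩ := hbound _ (hg.continuousOn_fderivWithin uniqueDiffOn_Dom (by norm_num))
  obtain ⟨Y, hY⟩ := exists_norm_le_mul_bigN_add hp hq hρ hℓ
    (show 0 < cg / (2 * (A + 1)) by positivity)
  obtain ⟨Z, hZ⟩ := exists_norm_le_mul_bigN_add hp hq hρ hℓ one_pos
  set C₁ := cg + E + (A + 1) * Y + A * R with hC₁
  set C₂ := |B| + D + G * (1 + |Z| + |R|) with hC₂
  have hC₂0 : 0 ≤ C₂ := by positivity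
  set N₀ := max 1 (4 * C₁ / cg) with hN₀
  obtain ⟨L, hL0, hL⟩ := exists_taylor_bound hg (max R (N₀ + Z))
  refine ⟨max (8 * C₂ / cg) (2 * L / c), fun x hx xb hxb hxbR => ?_⟩
  have hN := bigN_nonneg p q ρ ℓ x
  have hlow := le_erel hc hC3 hconv hx hxb
  have herel0 : 0 ≤ erel eh x xb := le_trans (by positivity) hlow
  rcases le_total N₀ (bigN p q ρ ℓ x) with hlarge | hsmall
  · have hN1 : 1 ≤ bigN p q ρ ℓ x := (le_max_left _ _).trans hlarge
    have hN2 : 4 * C₁ ≤ bigN p q ρ ℓ x * cg :=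
      (div_le_iff₀ hcg).1 ((le_max_right _ _).trans hlarge)
    have hsub : ‖x - xb‖ ≤ ‖x‖ + R := (norm_sub_le _ _).trans (by linarith)
    have hener : cg / 4 * bigN p q ρ ℓ x ≤ erel eh x xb := by
      have h1 : |fderivWithin ℝ eh Dom xb (x - xb)| ≤ A * (‖x‖ + R) :=
        ((fderivWithin ℝ eh Dom xb).le_opNorm _).trans
          (mul_le_mul (hA xb hxb hxbR) hsub (norm_nonneg _) hA0)
      have h2 : (A + 1) * ‖x‖ ≤ cg / 2 * bigN p q ρ ℓ x + (A + 1) * Y := by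
        calc (A + 1) * ‖x‖ ≤ (A + 1) * (cg / (2 * (A + 1)) * bigN p q ρ ℓ x + Y) :=
              mul_le_mul_of_nonneg_left (hY x) (by positivity)
          _ = _ := by field_simp
      have h3 := (hG1 x hx).1
      have h4 := (abs_le.1 (hE xb hxb hxbR)).2
      have h5 := (abs_le.1 h1).2
      rw [erel_eq]
      linarith [norm_nonneg x]
    have hstress : |relS eh x xb d| ≤ C₂ * (bigN p q ρ ℓ x + 1) := by
      have h1 : |fderivWithin ℝ (fun y => dXi eh y d) Dom xb (x - xb)| ≤ G * (‖x‖ + R) :=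
        ((fderivWithin ℝ (fun y => dXi eh y d) Dom xb).le_opNorm _).trans
          (mul_le_mul (hG xb hxb hxbR) hsub (norm_nonneg _) hG0)
      have h2 : G * (‖x‖ + R) ≤ G * ((1 + |Z| + |R|) * (bigN p q ρ ℓ x + 1)) := by
        refine mul_le_mul_of_nonneg_left ?_ hG0
        nlinarith [hZ x, le_abs_self Z, le_abs_self R, abs_nonneg Z, abs_nonneg R]
      have h3 : D ≤ D * (bigN p q ρ ℓ x + 1) := le_mul_of_one_le_right hD0 (by linarith)
      have h4 : |dXi eh x d| ≤ |B| * (bigN p q ρ ℓ x + 1) := (hB x hx).trans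
        (mul_le_mul_of_nonneg_right (le_abs_self B) (by linarith))
      have h5 : |dXi eh xb d| ≤ D := hD xb hxb hxbR
      calc |relS eh x xb d|
          ≤ |dXi eh x d| + |dXi eh xb d|
            + |fderivWithin ℝ (fun y => dXi eh y d) Dom xb (x - xb)| :=
            (abs_sub _ _).trans (add_le_add_left (abs_sub _ _) _)
        _ ≤ C₂ * (bigN p q ρ ℓ x + 1) := by rw [hC₂]; linarith
    calc |relS eh x xb d| ≤ C₂ * (bigN p q ρ ℓ x + 1) := hstress
      _ ≤ C₂ * (2 * bigN p q ρ ℓ x) := mul_le_mul_of_nonneg_left (by linarith) hC₂0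
      _ = 8 * C₂ / cg * (cg / 4 * bigN p q ρ ℓ x) := by field_simp; ring
      _ ≤ 8 * C₂ / cg * erel eh x xb := mul_le_mul_of_nonneg_left hener (by positivity)
      _ ≤ _ := mul_le_mul_of_nonneg_right (le_max_left _ _) herel0
  · have hxR : ‖x‖ ≤ N₀ + Z := by linarith [hZ x]
    calc |relS eh x xb d| ≤ L * ‖x - xb‖ ^ 2 :=
          hL x hx xb hxb (hxR.trans (le_max_right _ _)) (hxbR.trans (le_max_left _ _))
      _ = 2 * L / c * (c / 2 * ‖x - xb‖ ^ 2) := by field_simp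
      _ ≤ 2 * L / c * erel eh x xb := mul_le_mul_of_nonneg_left hlow (by positivity)
      _ ≤ _ := mul_le_mul_of_nonneg_right (le_max_right _ _) herel0

lemma GrowthG3.abs_partial_le {cg p q ρ ℓ : ℝ} {eh : XE → ℝ} (hG3 : GrowthG3 eh cg p q ρ ℓ)
    (hcg : 0 < cg) (hp : 4 ≤ p) {x : XE} (hx : x ∈ Dom) :
    (∀ i j, |dFmat eh x i j| ≤ (cg + 1) * (bigN p q ρ ℓ x + 1)) ∧
      (∀ i j, |dZmat eh x i j| ≤ (cg + 1) * (bigN p q ρ ℓ x + 1)) ∧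
      |dW eh x| ≤ (cg + 1) * (bigN p q ρ ℓ x + 1) := by
  have hN := bigN_nonneg p q ρ ℓ x
  have h := hG3 x hx
  have h1 : 0 ≤ frob (dFmat eh x) ^ (p / (p - 1)) := Real.rpow_nonneg (frob_nonneg _) _
  have h2 : 0 ≤ frob (dZmat eh x) ^ (p / (p - 2)) := Real.rpow_nonneg (frob_nonneg _) _
  have h3 : 0 ≤ |dW eh x| ^ (p / (p - 3)) := by positivity
  have hy : 0 ≤ cg * bigN p q ρ ℓ x + cg := by positivity
  have hr1 : 1 ≤ p / (p - 1) := (one_le_div (by linarith)).2 (by linarith)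
  have hr2 : 1 ≤ p / (p - 2) := (one_le_div (by linarith)).2 (by linarith)
  have hr3 : 1 ≤ p / (p - 3) := (one_le_div (by linarith)).2 (by linarith)
  have hle : cg * bigN p q ρ ℓ x + cg + 1 ≤ (cg + 1) * (bigN p q ρ ℓ x + 1) := by linarith
  refine ⟨fun i j => ?_, fun i j => ?_, ?_⟩
  · exact ((abs_apply_le_frob _ i j).trans
      (le_add_one_of_rpow_le hr1 hy (by linarith))).trans hle
  · exact ((abs_apply_le_frob _ i j).trans
      (le_add_one_of_rpow_le hr2 hy (by linarith))).trans hle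
  · exact (le_add_one_of_rpow_le hr3 hy (by linarith)).trans hle

lemma continuous_Phi : Continuous Phi := by
  unfold Phi cof mdet
  fun_prop

lemma exists_norm_Phi_le (M : ℝ) :
    ∃ R, ∀ (F : Mat) (η : ℝ), frob F ≤ M → 0 ≤ η → η ≤ M → ‖((Phi F, η) : XE)‖ ≤ R := by
  obtain ⟨R, hR⟩ := (isCompact_closedBall (0 : Mat) M).exists_bound_of_continuousOn
    continuous_Phi.continuousOn
  refine ⟨max R M, fun F η hF h0 hη => norm_prod_le_iff.2 ⟨?_, ?_⟩⟩
  · exact (hR F (by simpa using (norm_le_frob F).trans hF)).trans (le_max_left _ _)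
  · rw [Real.norm_eq_abs, abs_of_nonneg h0]
    exact hη.trans (le_max_right _ _)

lemma relSnorm_le {eh : XE → ℝ} {x xb : XE} {b : ℝ} (hb : 0 ≤ b)
    (h1 : ∀ i j, |relS eh x xb (Pi.single i (Pi.single j 1), 0, 0)| ≤ b)
    (h2 : ∀ i j, |relS eh x xb (0, Pi.single i (Pi.single j 1), 0)| ≤ b)
    (h3 : |relS eh x xb (0, 0, 1)| ≤ b) : relSnorm eh x xb ≤ 5 * b := by
  refine Real.sqrt_le_iff.2 ⟨by positivity, ?_⟩
  have hsum : ∀ a : Fin 3 → Fin 3 → ℝ, (∀ i j, |a i j| ≤ b) → ∑ i, ∑ j, a i j ^ 2 ≤ 9 * b ^ 2 :=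
    fun a ha => by
      calc ∑ i, ∑ j, a i j ^ 2 ≤ ∑ _i : Fin 3, ∑ _j : Fin 3, b ^ 2 :=
            Finset.sum_le_sum fun i _ => Finset.sum_le_sum fun j _ =>
              sq_le_sq' (abs_le.1 (ha i j)).1 (abs_le.1 (ha i j)).2
        _ = 9 * b ^ 2 := by simp; ring
  have h4 := hsum _ h1
  have h5 := hsum _ h2
  have h6 := sq_le_sq' (abs_le.1 h3).1 (abs_le.1 h3).2
  nlinarith [sq_nonneg b]

/-- relative entropy estimate, part (II): relative stress bound.
Under uniform convexity and (G1)–(G3), for every `M > 0` there is `C₂ > 0` such that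
`|(∇_ξ eh)(Φ(F),η | Φ(F̄),η̄)| ≤ C₂ I(v,Φ(F),η | v̄,Φ(F̄),η̄)` for all `(F,v,η)` and
`(F̄,v̄,η̄) ∈ Γ_M`. -/
theorem relative_stress_bound
    (c cg p q ρ ℓ : ℝ) (eh : XE → ℝ)
    (hc : 0 < c) (hcg : 0 < cg)
    (hp : 4 ≤ p) (hq : 2 ≤ q) (hρ : 1 < ρ) (hℓ : 1 < ℓ)
    (hC3 : ContDiffOn ℝ 3 eh Dom)
    (hconv : UnifConvex eh c)
    (hG1 : GrowthG1 eh cg p q ρ ℓ)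
    (hG2 : GrowthG2 eh p q ρ ℓ)
    (hG3 : GrowthG3 eh cg p q ρ ℓ)
    :
    ∀ M > (0:ℝ), ∃ C₂ > (0:ℝ),
      ∀ (F Fb : Mat) (v vb : Fin 3 → ℝ) (η ηb : ℝ),
        0 ≤ η → Gam M Fb vb ηb →
        relSnorm eh (Phi F, η) (Phi Fb, ηb)
          ≤ C₂ * relI eh v vb (Phi F, η) (Phi Fb, ηb) := by
  intro M hM
  obtain ⟨R, hR⟩ := exists_norm_Phi_le M
  have hevent : ∀ d : Xi,
      (∀ x ∈ Dom, |dXi eh x d| ≤ (cg + 1) * (bigN p q ρ ℓ x + 1)) →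
      ∀ᶠ K in Filter.atTop, ∀ x ∈ Dom, ∀ xb ∈ Dom, ‖xb‖ ≤ R →
        |relS eh x xb d| ≤ K * erel eh x xb := fun d hd => by
    obtain ⟨K₀, hK₀⟩ := exists_abs_relS_le hc hcg (by linarith) (by linarith) hρ hℓ hC3 hconv
      hG1 hd R
    filter_upwards [Filter.eventually_ge_atTop K₀] with K hK x hx xb hxb hxbR
    exact (hK₀ x hx xb hxb hxbR).trans (mul_le_mul_of_nonneg_right hK
      (le_trans (by positivity) (le_erel hc hC3 hconv hx hxb)))
  obtain ⟨K, hK1, hK2, hK3, hK0⟩ := Filter.Eventually.exists <|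
    (Filter.eventually_all.2 fun i => Filter.eventually_all.2 fun j =>
      hevent (Pi.single i (Pi.single j 1), 0, 0) fun x hx =>
        (hG3.abs_partial_le hcg hp hx).1 i j).and <|
    (Filter.eventually_all.2 fun i => Filter.eventually_all.2 fun j =>
      hevent (0, Pi.single i (Pi.single j 1), 0) fun x hx =>
        (hG3.abs_partial_le hcg hp hx).2.1 i j).and <|
    (hevent (0, 0, 1) fun x hx => (hG3.abs_partial_le hcg hp hx).2.2).and <|
    Filter.eventually_gt_atTop (0 : ℝ)
  refine ⟨5 * K, by positivity, fun F Fb v vb η ηb hη hΓ => ?_⟩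
  have hx : ((Phi F, η) : XE) ∈ Dom := hη
  have hxb : ((Phi Fb, ηb) : XE) ∈ Dom := hΓ.2.2.1
  have hxbR : ‖((Phi Fb, ηb) : XE)‖ ≤ R := hR Fb ηb hΓ.1 hΓ.2.2.1 hΓ.2.2.2
  have herel : 0 ≤ erel eh (Phi F, η) (Phi Fb, ηb) :=
    le_trans (by positivity) (le_erel hc hC3 hconv hx hxb)
  have hrelI : erel eh (Phi F, η) (Phi Fb, ηb) ≤ relI eh v vb (Phi F, η) (Phi Fb, ηb) :=
    le_add_of_nonneg_left (by positivity)
  calc relSnorm eh (Phi F, η) (Phi Fb, ηb)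
      ≤ 5 * (K * erel eh (Phi F, η) (Phi Fb, ηb)) :=
        relSnorm_le (by positivity) (fun i j => hK1 i j _ hx _ hxb hxbR)
          (fun i j => hK2 i j _ hx _ hxb hxbR) (hK3 _ hx _ hxb hxbR)
    _ = 5 * K * erel eh (Phi F, η) (Phi Fb, ηb) := by ring
    _ ≤ 5 * K * relI eh v vb (Phi F, η) (Phi Fb, ηb) :=
        mul_le_mul_of_nonneg_left hrelI (by positivity)
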